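/- Let f : ℝ^N → ℝ be L-smooth and let μ ∈ ℝ^N have μ_j > 0 for every j. Then for every x ∈ ℝ^N, the average over the coordinates of the squared deviation between the central-difference quotients and the true partial derivatives satisfies (1/N) ∑_{j=1}^N ((f(x + μ_j e_j) − f(x − μ_j e_j))/(2μ_j) − ∂_j f(x))² ≤ L² (∑_{j=1}^N μ_j²)/(4N); equivalently, writing ω = L²(∑_{j=1}^N μ_j²)/N, this average is at most ω/4. -/

import Mathlib

open Set in
/-- For a function with `L`-Lipschitz gradient, the symmetric difference `f (x + v) - f (x - v)`
agrees with its linearization up to `L * ‖v‖ ^ 2`. -/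
theorem abs_symmetric_difference_sub_inner_gradient_le {F : Type*} [NormedAddCommGroup F]
    [InnerProductSpace ℝ F] [CompleteSpace F] {L : ℝ} {f : F → ℝ} (hdiff : Differentiable ℝ f)
    (hL : ∀ x y : F, ‖gradient f x - gradient f y‖ ≤ L * ‖x - y‖) (x v : F) :
    |f (x + v) - f (x - v) - 2 * inner ℝ (gradient f x) v| ≤ L * ‖v‖ ^ 2 := by
  have hline (w : F) (t : ℝ) :
      HasDerivAt (fun s : ℝ => f (x + s • w)) (inner ℝ (gradient f (x + t • w)) w) t := by
    have hw : HasDerivAt (fun s : ℝ => x + s • w) w t := by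
      simpa using ((hasDerivAt_id t).smul_const w).const_add x
    simpa [Function.comp_def] using
      (hdiff (x + t • w)).hasGradientAt.hasFDerivAt.comp_hasDerivAt t hw
  have hslope (w : F) (t : ℝ) (ht : 0 ≤ t) :
      |inner ℝ (gradient f (x + t • w) - gradient f x) w| ≤ L * t * ‖w‖ ^ 2 := by
    calc
      _ ≤ ‖gradient f (x + t • w) - gradient f x‖ * ‖w‖ := abs_real_inner_le_norm _ _
      _ ≤ L * ‖x + t • w - x‖ * ‖w‖ := by gcongr; exact hL _ _
      _ = L * t * ‖w‖ ^ 2 := by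
        rw [add_sub_cancel_left, norm_smul, Real.norm_of_nonneg ht]; ring
  have hderiv (t : ℝ) : HasDerivAt
      (fun s : ℝ => f (x + s • v) - f (x + s • (-v)) - s * (2 * inner ℝ (gradient f x) v))
      (inner ℝ (gradient f (x + t • v)) v - inner ℝ (gradient f (x + t • (-v))) (-v)
        - 1 * (2 * inner ℝ (gradient f x) v)) t :=
    ((hline v t).sub (hline (-v) t)).sub ((hasDerivAt_id t).mul_const _)
  have hbound (t : ℝ) : HasDerivAt (fun s : ℝ => L * ‖v‖ ^ 2 * s ^ 2)
      (L * ‖v‖ ^ 2 * (2 * t)) t := by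
    simpa using (hasDerivAt_pow 2 t).const_mul (L * ‖v‖ ^ 2)
  have h := image_norm_le_of_norm_deriv_right_le_deriv_boundary (a := 0) (b := 1)
    (fun t _ => (hderiv t).continuousAt.continuousWithinAt)
    (fun t _ => (hderiv t).hasDerivWithinAt) (by simp) hbound
    (fun t ht => by
      have h₁ := abs_le.1 (hslope v t ht.1)
      have h₂ := abs_le.1 (hslope (-v) t ht.1)
      simp only [inner_sub_left, inner_neg_right, norm_neg] at h₁ h₂ ⊢
      rw [Real.norm_eq_abs, abs_le]
      constructor <;> linarith [h₁.1, h₁.2, h₂.1, h₂.2])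
    (right_mem_Icc.2 zero_le_one)
  simpa [sub_eq_add_neg] using h

/-- For an `L`-smooth `f` and positive stepsizes `μ j`, the average over the
coordinates of the squared deviation between the central-difference quotients and the true
partial derivatives is at most `L² (∑ j, μ j ²) / (4N) = ω/4` where `ω = L² (∑ j, μ j ²)/N`. -/
theorem stmt_2 (N : ℕ) (L : ℝ) (f : EuclideanSpace ℝ (Fin N) → ℝ)
    (hdiff : Differentiable ℝ f)
    (hL : ∀ x y : EuclideanSpace ℝ (Fin N), ‖gradient f x - gradient f y‖ ≤ L * ‖x - y‖)
    (μ : Fin N → ℝ) (hμ : ∀ j, 0 < μ j) (x : EuclideanSpace ℝ (Fin N)) :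
    (1 / (N : ℝ)) *
        ∑ j : Fin N,
          ((f (x + μ j • EuclideanSpace.single j (1 : ℝ)) -
              f (x - μ j • EuclideanSpace.single j (1 : ℝ))) / (2 * μ j) - gradient f x j) ^ 2
      ≤ L ^ 2 * (∑ j : Fin N, (μ j) ^ 2) / (4 * N) := by
  have hcoord (j : Fin N) :
      ((f (x + μ j • EuclideanSpace.single j (1 : ℝ)) -
        f (x - μ j • EuclideanSpace.single j (1 : ℝ))) / (2 * μ j) - gradient f x j) ^ 2
        ≤ L ^ 2 * μ j ^ 2 / 4 := by
    have hj := hμ j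
    have h := abs_symmetric_difference_sub_inner_gradient_le hdiff hL x
      (μ j • EuclideanSpace.single j (1 : ℝ))
    rw [inner_smul_right, EuclideanSpace.inner_single_right, norm_smul,
      PiLp.norm_single, Real.norm_of_nonneg hj.le] at h
    simp only [norm_one, mul_one, one_mul, conj_trivial] at h
    set d := f (x + μ j • EuclideanSpace.single j (1 : ℝ)) -
      f (x - μ j • EuclideanSpace.single j (1 : ℝ))
    have hquot : d / (2 * μ j) - gradient f x j
        = (d - 2 * (μ j * gradient f x j)) / (2 * μ j) := by
      field_simp
    calc
      _ = |d - 2 * (μ j * gradient f x j)| ^ 2 / (2 * μ j) ^ 2 := by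
        rw [hquot, div_pow, sq_abs]
      _ ≤ (L * μ j ^ 2) ^ 2 / (2 * μ j) ^ 2 := by gcongr
      _ = L ^ 2 * μ j ^ 2 / 4 := by field_simp; ring
  calc
    _ ≤ (1 / (N : ℝ)) * ∑ j : Fin N, L ^ 2 * μ j ^ 2 / 4 := by
      gcongr with j
      exact hcoord j
    _ = L ^ 2 * (∑ j : Fin N, μ j ^ 2) / (4 * N) := by
      rw [← Finset.sum_div, ← Finset.mul_sum, one_div_mul_eq_div, div_div]
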